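/- Under Assumption 1.1, for every λ > 0 the Neumann resolvent densities converge uniformly: sup_{x,y∈[0,1]} |ρ_λ^N(x,y) − ρ_{λ,n}^N(x,y)| ≤ (1/λ + 2e^λ + 4) e^{2λ} ‖F − F_n‖_∞ → 0 as n → ∞. -/

import Mathlib

open MeasureTheory Set Real Filter

noncomputable def genP (μ : Measure ℝ) : ℕ → ℝ → ℝ
  | 0 => fun _ => 1
  | k + 1 => fun x =>
      if Odd (k + 1) then ∫ t in (0:ℝ)..x, genP μ k t ∂μ
      else ∫ t in (0:ℝ)..x, genP μ k t

noncomputable def genQ (μ : Measure ℝ) : ℕ → ℝ → ℝ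
  | 0 => fun _ => 1
  | k + 1 => fun x =>
      if Odd (k + 1) then ∫ t in (0:ℝ)..x, genQ μ k t
      else ∫ t in (0:ℝ)..x, genQ μ k t ∂μ

noncomputable def genCosh (μ : Measure ℝ) (z : ℝ) (x : ℝ) : ℝ :=
  ∑' k : ℕ, z ^ (2 * k) * genP μ (2 * k) x

noncomputable def genSinh (μ : Measure ℝ) (z : ℝ) (x : ℝ) : ℝ :=
  ∑' k : ℕ, z ^ (2 * k + 1) * genQ μ (2 * k + 1) x

/-- sup-distance between distribution functions on [0,1] -/
noncomputable def distSup (μ ν : Measure ℝ) : ℝ :=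
  ⨆ x : Set.Icc (0:ℝ) 1, |(μ (Set.Icc 0 (x:ℝ))).toReal - (ν (Set.Icc 0 (x:ℝ))).toReal|


/-- cosh'_{√λ}(1) = Σ_{k≥1} λ^k p_{2k-1}(1) -/
noncomputable def coshDerivOne (μ : Measure ℝ) (l : ℝ) : ℝ :=
  ∑' k : ℕ, l ^ (k + 1) * genP μ (2 * k + 1) 1

/-- Neumann resolvent density -/
noncomputable def rhoN (μ : Measure ℝ) (l : ℝ) (x y : ℝ) : ℝ :=
  genCosh μ (Real.sqrt l) (min x y) * genCosh μ (Real.sqrt l) (1 - max x y)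
    / coshDerivOne μ l

section helpers

variable {μ ν : Measure ℝ}

theorem genP_odd (μ : Measure ℝ) (k : ℕ) (x : ℝ) :
    genP μ (2 * k + 1) x = ∫ t in (0:ℝ)..x, genP μ (2 * k) t ∂μ := by
  have h : Odd (2 * k + 1) := ⟨k, rfl⟩
  simp only [genP, h, if_true]

theorem genP_even (μ : Measure ℝ) (k : ℕ) (x : ℝ) :
    genP μ (2 * (k + 1)) x = ∫ t in (0:ℝ)..x, genP μ (2 * k + 1) t := by
  have h : ¬ Odd (2 * k + 1 + 1) := by
    rw [Nat.not_odd_iff_even]; exact ⟨k + 1, by ring⟩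
  show genP μ (2 * k + 1 + 1) x = _
  rw [genP]
  simp only [h, if_false]

theorem genP_cont (μ : Measure ℝ) [IsProbabilityMeasure μ] [NullSingletonClass μ] (k : ℕ) :
    Continuous (genP μ k) := by
  induction k with
  | zero => simp only [genP]; exact continuous_const
  | succ k ih =>
    by_cases h : Odd (k + 1)
    · simp only [genP, h, if_true]
      exact intervalIntegral.continuous_primitive (fun a b => ih.intervalIntegrable a b) 0
    · simp only [genP, h, if_false]
      exact intervalIntegral.continuous_primitive (fun a b => ih.intervalIntegrable a b) 0

theorem lemA (μ : Measure ℝ) [IsProbabilityMeasure μ] {f : ℝ → ℝ} {x C : ℝ}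
    (hx : 0 ≤ x) (hC : 0 ≤ C) (h : ∀ t, 0 ≤ t → t ≤ x → |f t| ≤ C) :
    |∫ t in (0:ℝ)..x, f t ∂μ| ≤ C := by
  rw [intervalIntegral.integral_of_le hx, ← Real.norm_eq_abs]
  refine (norm_setIntegral_le_of_norm_le_const (C := C) (measure_lt_top μ _)
    (fun t ht => h t ht.1.le ht.2)).trans ?_
  exact mul_le_of_le_one_right hC measureReal_le_one

theorem lemB {f : ℝ → ℝ} {x c : ℝ} (k : ℕ)
    (hx : 0 ≤ x) (h : ∀ t, 0 ≤ t → t ≤ x → |f t| ≤ c * (t ^ k / k.factorial)) :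
    |∫ t in (0:ℝ)..x, f t| ≤ c * (x ^ (k + 1) / (k + 1).factorial) := by
  rw [← Real.norm_eq_abs]
  have h1 : ∫ t in (0:ℝ)..x, c * (t ^ k / k.factorial) =
      c * (x ^ (k + 1) / (k + 1).factorial) := by
    rw [intervalIntegral.integral_const_mul, intervalIntegral.integral_div, integral_pow,
      Nat.factorial_succ]
    push_cast
    have : (k.factorial : ℝ) ≠ 0 := by positivity
    have : (k : ℝ) + 1 ≠ 0 := by positivity
    field_simp
    simp
  rw [← h1]
  refine intervalIntegral.norm_integral_le_of_norm_le hx ?_ ?_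
  · exact Eventually.of_forall (fun t ht => h t ht.1.le ht.2)
  · exact Continuous.intervalIntegrable (by fun_prop) _ _

theorem genP_nonneg (μ : Measure ℝ) (k : ℕ) : ∀ x, 0 ≤ x → 0 ≤ genP μ k x := by
  induction k with
  | zero => intro x _; simp [genP]
  | succ k ih =>
    intro x hx
    by_cases h : Odd (k + 1)
    · simp only [genP, h, if_true]
      exact intervalIntegral.integral_nonneg hx (fun t ht => ih t ht.1)
    · simp only [genP, h, if_false]
      exact intervalIntegral.integral_nonneg hx (fun t ht => ih t ht.1)

theorem odd_of_even (μ : Measure ℝ) [IsProbabilityMeasure μ] (k : ℕ)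
    (h : ∀ x, 0 ≤ x → |genP μ (2 * k) x| ≤ x ^ k / k.factorial) :
    ∀ x, 0 ≤ x → |genP μ (2 * k + 1) x| ≤ x ^ k / k.factorial := by
  intro x hx
  rw [genP_odd]
  refine lemA μ hx (by positivity) (fun t ht htx => (h t ht).trans ?_)
  gcongr

theorem even_bd (μ : Measure ℝ) [IsProbabilityMeasure μ] (k : ℕ) :
    ∀ x, 0 ≤ x → |genP μ (2 * k) x| ≤ x ^ k / k.factorial := by
  induction k with
  | zero => intro x _; simp [genP]
  | succ k ih =>
    intro x hx
    rw [genP_even]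
    have := lemB (f := genP μ (2 * k + 1)) (x := x) (c := 1) k hx
      (fun t ht _ => by rw [one_mul]; exact odd_of_even μ k ih t ht)
    simpa using this

theorem odd_bd (μ : Measure ℝ) [IsProbabilityMeasure μ] (k : ℕ) :
    ∀ x, 0 ≤ x → |genP μ (2 * k + 1) x| ≤ x ^ k / k.factorial :=
  odd_of_even μ k (even_bd μ k)

theorem lemC (μ : Measure ℝ) [IsProbabilityMeasure μ] [NullSingletonClass μ] {g : ℝ → ℝ}
    (hg : Continuous g) {x : ℝ} (hx : 0 ≤ x) :
    ∫ t in (0:ℝ)..x, (∫ s in (0:ℝ)..t, g s) ∂μ =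
      ∫ s in (0:ℝ)..x, g s * ∫ _t in s..x, (1:ℝ) ∂μ := by
  rw [intervalIntegral.integral_of_le hx, intervalIntegral.integral_of_le hx]
  have h1 : ∫ t in Ioc 0 x, (∫ s in (0:ℝ)..t, g s) ∂μ =
      ∫ t in Ioc 0 x, (∫ s in Ioc 0 x, {p : ℝ × ℝ | p.2 ≤ p.1}.indicator (fun p => g p.2) (t, s)) ∂μ := by
    refine setIntegral_congr_fun measurableSet_Ioc (fun t ht => ?_)
    have e : (fun s => {p : ℝ × ℝ | p.2 ≤ p.1}.indicator (fun p => g p.2) (t, s)) =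
        (Iic t).indicator g := by
      ext s; simp [indicator]
    simp only [e]
    rw [setIntegral_indicator measurableSet_Iic, intervalIntegral.integral_of_le ht.1.le]
    congr 2
    ext s; simp only [mem_Ioc, mem_inter_iff, mem_Iic]
    constructor
    · rintro ⟨a, b⟩; exact ⟨⟨a, b.trans ht.2⟩, b⟩
    · rintro ⟨⟨a, _⟩, b⟩; exact ⟨a, b⟩
  rw [h1, integral_integral_swap]
  · refine setIntegral_congr_fun measurableSet_Ioc (fun s hs => ?_)
    have e : (fun t => {p : ℝ × ℝ | p.2 ≤ p.1}.indicator (fun p => g p.2) (t, s)) =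
        (Ici s).indicator (fun _ => g s) := by
      ext s; simp [indicator]
    simp only [e]
    rw [setIntegral_indicator measurableSet_Ici, intervalIntegral.integral_of_le hs.2]
    have e2 : Ioc 0 x ∩ Ici s = Icc s x := by
      ext t; simp only [mem_Ioc, mem_inter_iff, mem_Ici, mem_Icc]
      constructor
      · rintro ⟨⟨_, a⟩, b⟩; exact ⟨b, a⟩
      · rintro ⟨a, b⟩; exact ⟨⟨hs.1.trans_le a, b⟩, a⟩
    rw [e2, integral_Icc_eq_integral_Ioc]
    simp [mul_comm]
  · have hgi : Integrable g (volume.restrict (Ioc 0 x)) :=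
      (hg.integrableOn_Icc (a := 0) (b := x)).mono_set Ioc_subset_Icc_self
    exact (hgi.comp_snd (μ.restrict (Ioc 0 x))).indicator
      (measurableSet_le measurable_snd measurable_fst)

theorem lemD (μ ν : Measure ℝ) [IsProbabilityMeasure μ] [NullSingletonClass μ]
    [IsProbabilityMeasure ν] [NullSingletonClass ν] {g : ℝ → ℝ}
    (hg : Continuous g) {x c b : ℝ} (hx : 0 ≤ x) (k : ℕ) (hc : 0 ≤ c)
    (hb : ∀ t, 0 ≤ t → t ≤ x → |g t| ≤ t ^ k / k.factorial)
    (hd : ∀ s, 0 ≤ s → s ≤ x → |(∫ _t in s..x, (1:ℝ) ∂μ) - ∫ _t in s..x, (1:ℝ) ∂ν| ≤ c) :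
    |(∫ t in (0:ℝ)..x, (∫ s in (0:ℝ)..t, g s) ∂μ) - ∫ t in (0:ℝ)..x, (∫ s in (0:ℝ)..t, g s) ∂ν|
      ≤ c * (x ^ (k + 1) / (k + 1).factorial) := by
  have hcont : ∀ (ρ : Measure ℝ) [IsProbabilityMeasure ρ] [NullSingletonClass ρ],
      Continuous (fun s => ∫ _t in s..x, (1:ℝ) ∂ρ) := by
    intro ρ _ _
    have : (fun s => ∫ _t in s..x, (1:ℝ) ∂ρ) = fun s => -∫ _t in x..s, (1:ℝ) ∂ρ := by
      ext s; rw [intervalIntegral.integral_symm]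
    rw [this]
    exact (intervalIntegral.continuous_primitive
      (fun a b => continuous_const.intervalIntegrable a b) x).neg
  have i1 : IntervalIntegrable (fun s => g s * ∫ _t in s..x, (1:ℝ) ∂μ) volume 0 x :=
    (hg.mul (hcont μ)).intervalIntegrable _ _
  have i2 : IntervalIntegrable (fun s => g s * ∫ _t in s..x, (1:ℝ) ∂ν) volume 0 x :=
    (hg.mul (hcont ν)).intervalIntegrable _ _
  rw [lemC μ hg hx, lemC ν hg hx, ← intervalIntegral.integral_sub i1 i2]
  refine lemB k hx (fun t ht htx => ?_)
  rw [← mul_sub, abs_mul, mul_comm]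
  exact mul_le_mul (hd t ht htx) (hb t ht htx) (abs_nonneg _) hc

theorem one_int (μ : Measure ℝ) [IsProbabilityMeasure μ] [NullSingletonClass μ] {x : ℝ} (hx : 0 ≤ x) :
    ∫ _t in (0:ℝ)..x, (1:ℝ) ∂μ = (μ (Icc 0 x)).toReal := by
  rw [intervalIntegral.integral_of_le hx, ← integral_Icc_eq_integral_Ioc]
  simp [Measure.real]

theorem one_int' (μ : Measure ℝ) [IsProbabilityMeasure μ] [NullSingletonClass μ] {s x : ℝ} (hs : 0 ≤ s)
    (hx : s ≤ x) :
    ∫ _t in s..x, (1:ℝ) ∂μ = (μ (Icc 0 x)).toReal - (μ (Icc 0 s)).toReal := by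
  rw [← one_int μ hs, ← one_int μ (hs.trans hx), intervalIntegral.integral_interval_sub_left]
  · exact continuous_const.intervalIntegrable _ _
  · exact continuous_const.intervalIntegrable _ _

theorem le_distSup (μ ν : Measure ℝ) [IsProbabilityMeasure μ] [IsProbabilityMeasure ν] {x : ℝ}
    (hx : x ∈ Icc (0:ℝ) 1) :
    |(μ (Icc 0 x)).toReal - (ν (Icc 0 x)).toReal| ≤ distSup μ ν := by
  refine le_ciSup (f := fun x : Icc (0:ℝ) 1 =>
    |(μ (Icc 0 (x:ℝ))).toReal - (ν (Icc 0 (x:ℝ))).toReal|) ⟨1, ?_⟩ ⟨x, hx⟩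
  rintro _ ⟨y, rfl⟩
  have h1 : (μ (Icc 0 (y:ℝ))).toReal ≤ 1 := measureReal_le_one
  have h2 : (ν (Icc 0 (y:ℝ))).toReal ≤ 1 := measureReal_le_one
  have h3 : 0 ≤ (μ (Icc 0 (y:ℝ))).toReal := ENNReal.toReal_nonneg
  have h4 : 0 ≤ (ν (Icc 0 (y:ℝ))).toReal := ENNReal.toReal_nonneg
  exact abs_le.2 ⟨by linarith, by linarith⟩

theorem distSup_nonneg (μ ν : Measure ℝ) [IsProbabilityMeasure μ] [IsProbabilityMeasure ν] :
    0 ≤ distSup μ ν :=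
  (abs_nonneg _).trans (le_distSup μ ν (x := 0) (by simp))

theorem odd_step (μ ν : Measure ℝ) [IsProbabilityMeasure μ] [NullSingletonClass μ]
    [IsProbabilityMeasure ν] [NullSingletonClass ν] {x c a : ℝ} (hx : 0 ≤ x) (k : ℕ) (hc : 0 ≤ c) (ha : 0 ≤ a)
    (hd : ∀ s, 0 ≤ s → s ≤ x → |(∫ _t in s..x, (1:ℝ) ∂μ) - ∫ _t in s..x, (1:ℝ) ∂ν| ≤ c)
    (h : ∀ t, 0 ≤ t → t ≤ x → |genP μ (2 * (k + 1)) t - genP ν (2 * (k + 1)) t| ≤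
      a * (t ^ (k + 1) / (k + 1).factorial)) :
    |genP μ (2 * (k + 1) + 1) x - genP ν (2 * (k + 1) + 1) x| ≤
      (c + a) * (x ^ (k + 1) / (k + 1).factorial) := by
  rw [genP_odd, genP_odd]
  have h1 := lemD μ ν (b := 0) (genP_cont μ (2 * k + 1)) hx k hc (fun t ht _ => odd_bd μ k t ht) hd
  simp only [← genP_even] at h1
  have h2 : |∫ t in (0:ℝ)..x, (genP μ (2 * (k + 1)) t - genP ν (2 * (k + 1)) t) ∂ν| ≤
      a * (x ^ (k + 1) / (k + 1).factorial) := by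
    refine lemA ν hx (by positivity) (fun t ht htx => (h t ht htx).trans ?_)
    gcongr
  rw [intervalIntegral.integral_sub ((genP_cont μ _).intervalIntegrable _ _)
    ((genP_cont ν _).intervalIntegrable _ _)] at h2
  rw [add_mul]
  refine le_trans ?_ (add_le_add h1 h2)
  refine le_trans (le_of_eq ?_) (abs_add_le _ _)
  congr 1; ring

theorem even_of_odd_diff (μ ν : Measure ℝ) [IsProbabilityMeasure μ] [NullSingletonClass μ]
    [IsProbabilityMeasure ν] [NullSingletonClass ν] (k : ℕ) {a : ℝ}
    (h : ∀ x, 0 ≤ x → x ≤ 1 → |genP μ (2 * k + 1) x - genP ν (2 * k + 1) x| ≤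
      a * (x ^ k / k.factorial)) :
    ∀ x, 0 ≤ x → x ≤ 1 → |genP μ (2 * (k + 1)) x - genP ν (2 * (k + 1)) x| ≤
      a * (x ^ (k + 1) / (k + 1).factorial) := by
  intro x hx hx1
  rw [genP_even, genP_even, ← intervalIntegral.integral_sub
    ((genP_cont μ _).intervalIntegrable _ _) ((genP_cont ν _).intervalIntegrable _ _)]
  exact lemB k hx (fun t ht htx => h t ht (htx.trans hx1))

theorem odd_diff (μ ν : Measure ℝ) [IsProbabilityMeasure μ] [NullSingletonClass μ]
    [IsProbabilityMeasure ν] [NullSingletonClass ν] (k : ℕ) :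
    ∀ x, 0 ≤ x → x ≤ 1 → |genP μ (2 * k + 1) x - genP ν (2 * k + 1) x| ≤
      ((2 * k + 1) * distSup μ ν) * (x ^ k / k.factorial) := by
  have hD := distSup_nonneg μ ν
  induction k with
  | zero =>
    intro x hx hx1
    rw [genP_odd, genP_odd]
    simp only [mul_zero, genP]
    rw [one_int μ hx, one_int ν hx]
    simpa using le_distSup μ ν ⟨hx, hx1⟩
  | succ k ih =>
    intro x hx hx1
    have := odd_step μ ν (c := 2 * distSup μ ν) (a := (2 * k + 1) * distSup μ ν) hx k
      (by positivity) (by positivity) ?_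
      (fun t ht htx => even_of_odd_diff μ ν k ih t ht (htx.trans hx1))
    · refine this.trans (le_of_eq ?_)
      push_cast; ring
    · intro s hs hsx
      rw [one_int' μ hs hsx, one_int' ν hs hsx]
      have h1 := abs_le.1 (le_distSup μ ν ⟨hx, hx1⟩)
      have h2 := abs_le.1 (le_distSup μ ν ⟨hs, hsx.trans hx1⟩)
      exact abs_le.2 ⟨by linarith, by linarith⟩

theorem even_diff (μ ν : Measure ℝ) [IsProbabilityMeasure μ] [NullSingletonClass μ]
    [IsProbabilityMeasure ν] [NullSingletonClass ν] (k : ℕ) :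
    ∀ x, 0 ≤ x → x ≤ 1 → |genP μ (2 * (k + 1)) x - genP ν (2 * (k + 1)) x| ≤
      ((2 * k + 1) * distSup μ ν) * (x ^ (k + 1) / (k + 1).factorial) :=
  even_of_odd_diff μ ν k (odd_diff μ ν k)

theorem Icc_one (μ : Measure ℝ) [IsProbabilityMeasure μ] (hμ : μ (Icc (0:ℝ) 1)ᶜ = 0) :
    (μ (Icc (0:ℝ) 1)).toReal = 1 := by
  rw [(prob_compl_eq_zero_iff measurableSet_Icc).1 hμ]; simp

theorem odd_diff_one (μ ν : Measure ℝ) [IsProbabilityMeasure μ] [NullSingletonClass μ]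
    [IsProbabilityMeasure ν] [NullSingletonClass ν] (hμ : μ (Icc (0:ℝ) 1)ᶜ = 0) (hν : ν (Icc (0:ℝ) 1)ᶜ = 0)
    (k : ℕ) :
    |genP μ (2 * (k + 1) + 1) 1 - genP ν (2 * (k + 1) + 1) 1| ≤
      2 * distSup μ ν / k.factorial := by
  have hD := distSup_nonneg μ ν
  have := odd_step μ ν (c := distSup μ ν) (a := (2 * k + 1) * distSup μ ν) zero_le_one k
      (by positivity) (by positivity) ?_ (even_diff μ ν k)
  · refine this.trans (le_of_eq ?_)
    rw [Nat.factorial_succ]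
    have : (k.factorial : ℝ) ≠ 0 := by positivity
    push_cast
    field_simp
    ring
  · intro s hs hsx
    rw [one_int' μ hs hsx, one_int' ν hs hsx, Icc_one μ hμ, Icc_one ν hν]
    have h2 := abs_le.1 (le_distSup μ ν ⟨hs, hsx⟩)
    exact abs_le.2 ⟨by linarith, by linarith⟩

theorem p1_one (μ : Measure ℝ) [IsProbabilityMeasure μ] [NullSingletonClass μ] (hμ : μ (Icc (0:ℝ) 1)ᶜ = 0) :
    genP μ 1 1 = 1 := by
  have := genP_odd μ 0 1
  simp only [mul_zero, zero_add] at this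
  rw [this]
  simp only [genP]
  rw [one_int μ zero_le_one, Icc_one μ hμ]

theorem exp_hasSum (l : ℝ) : HasSum (fun k : ℕ => l ^ k / k.factorial) (Real.exp l) := by
  rw [Real.exp_eq_exp_ℝ]
  exact NormedSpace.expSeries_div_hasSum_exp l

theorem genCosh_eq (μ : Measure ℝ) {l : ℝ} (hl : 0 < l) (x : ℝ) :
    genCosh μ (Real.sqrt l) x = ∑' k : ℕ, l ^ k * genP μ (2 * k) x := by
  unfold genCosh
  refine tsum_congr (fun k => ?_)
  rw [pow_mul, Real.sq_sqrt hl.le]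

theorem even_term (μ : Measure ℝ) [IsProbabilityMeasure μ] {l : ℝ} (hl : 0 < l) {x : ℝ}
    (hx : x ∈ Icc (0:ℝ) 1) (k : ℕ) : ‖l ^ k * genP μ (2 * k) x‖ ≤ l ^ k / k.factorial := by
  rw [norm_mul, Real.norm_of_nonneg (by positivity : 0 ≤ l ^ k), div_eq_mul_one_div]
  have := even_bd μ k x hx.1
  gcongr
  refine this.trans ?_
  gcongr
  exact pow_le_one₀ hx.1 hx.2

theorem odd_term (μ : Measure ℝ) [IsProbabilityMeasure μ] {l : ℝ} (hl : 0 < l) (k : ℕ) :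
    ‖l ^ (k + 1) * genP μ (2 * k + 1) 1‖ ≤ l * (l ^ k / k.factorial) := by
  rw [norm_mul, Real.norm_of_nonneg (by positivity : 0 ≤ l ^ (k + 1)), pow_succ', mul_assoc,
    div_eq_mul_one_div (l ^ k)]
  have := odd_bd μ k 1 zero_le_one
  rw [one_pow] at this
  gcongr
  exact this

theorem even_summable (μ : Measure ℝ) [IsProbabilityMeasure μ] {l : ℝ} (hl : 0 < l) {x : ℝ}
    (hx : x ∈ Icc (0:ℝ) 1) : Summable (fun k : ℕ => l ^ k * genP μ (2 * k) x) :=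
  Summable.of_norm_bounded (exp_hasSum l).summable (even_term μ hl hx)

theorem odd_summable (μ : Measure ℝ) [IsProbabilityMeasure μ] {l : ℝ} (hl : 0 < l) :
    Summable (fun k : ℕ => l ^ (k + 1) * genP μ (2 * k + 1) 1) :=
  Summable.of_norm_bounded ((exp_hasSum l).mul_left l).summable (odd_term μ hl)

theorem cosh_bd (μ : Measure ℝ) [IsProbabilityMeasure μ] {l : ℝ} (hl : 0 < l) {x : ℝ}
    (hx : x ∈ Icc (0:ℝ) 1) : |genCosh μ (Real.sqrt l) x| ≤ Real.exp l := by
  rw [genCosh_eq μ hl]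
  exact tsum_of_norm_bounded (exp_hasSum l) (even_term μ hl hx)

theorem deriv_ge (μ : Measure ℝ) [IsProbabilityMeasure μ] [NullSingletonClass μ]
    (hμ : μ (Icc (0:ℝ) 1)ᶜ = 0) {l : ℝ} (hl : 0 < l) : l ≤ coshDerivOne μ l := by
  have := (odd_summable μ hl).le_tsum 0
    (fun k _ => mul_nonneg (by positivity) (genP_nonneg μ _ 1 zero_le_one))
  simpa [coshDerivOne, p1_one μ hμ] using this

theorem cosh_diff (μ ν : Measure ℝ) [IsProbabilityMeasure μ] [NullSingletonClass μ]
    [IsProbabilityMeasure ν] [NullSingletonClass ν] {l : ℝ} (hl : 0 < l) {x : ℝ}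
    (hx : x ∈ Icc (0:ℝ) 1) :
    |genCosh μ (Real.sqrt l) x - genCosh ν (Real.sqrt l) x| ≤
      2 * l * distSup μ ν * Real.exp l := by
  have hD := distSup_nonneg μ ν
  have h1 := even_summable μ hl hx
  have h2 := even_summable ν hl hx
  rw [genCosh_eq μ hl, genCosh_eq ν hl, ← h1.tsum_sub h2, (h1.sub h2).tsum_eq_zero_add]
  have e : l ^ 0 * genP μ (2 * 0) x - l ^ 0 * genP ν (2 * 0) x = 0 := by simp [genP]
  rw [e, zero_add, ← Real.norm_eq_abs]
  refine tsum_of_norm_bounded ((exp_hasSum l).mul_left (2 * l * distSup μ ν)) (fun k => ?_)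
  rw [← mul_sub, norm_mul, Real.norm_of_nonneg (by positivity : 0 ≤ l ^ (k + 1))]
  have h := even_diff μ ν k x hx.1 hx.2
  have hp : x ^ (k + 1) ≤ 1 := pow_le_one₀ hx.1 hx.2
  calc l ^ (k + 1) * ‖genP μ (2 * (k + 1)) x - genP ν (2 * (k + 1)) x‖
      ≤ l ^ (k + 1) * (((2 * (k + 1)) * distSup μ ν) * (1 / (k + 1).factorial)) := by
        gcongr
        refine h.trans ?_
        have hx0 := hx.1
        have hk : (2 * (k:ℝ) + 1) ≤ 2 * (k + 1) := by linarith
        gcongr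
    _ = _ := by
        rw [Nat.factorial_succ]
        have : (k.factorial : ℝ) ≠ 0 := by positivity
        push_cast
        field_simp
        ring

theorem deriv_diff (μ ν : Measure ℝ) [IsProbabilityMeasure μ] [NullSingletonClass μ]
    [IsProbabilityMeasure ν] [NullSingletonClass ν] (hμ : μ (Icc (0:ℝ) 1)ᶜ = 0) (hν : ν (Icc (0:ℝ) 1)ᶜ = 0)
    {l : ℝ} (hl : 0 < l) :
    |coshDerivOne μ l - coshDerivOne ν l| ≤ 2 * l ^ 2 * distSup μ ν * Real.exp l := by
  have hD := distSup_nonneg μ ν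
  have h1 := odd_summable μ hl
  have h2 := odd_summable ν hl
  unfold coshDerivOne
  rw [← h1.tsum_sub h2, (h1.sub h2).tsum_eq_zero_add]
  have e : l ^ (0 + 1) * genP μ (2 * 0 + 1) 1 - l ^ (0 + 1) * genP ν (2 * 0 + 1) 1 = 0 := by
    simp only [mul_zero, zero_add]
    rw [p1_one μ hμ, p1_one ν hν]; ring
  rw [e, zero_add, ← Real.norm_eq_abs]
  refine tsum_of_norm_bounded ((exp_hasSum l).mul_left (2 * l ^ 2 * distSup μ ν)) (fun k => ?_)
  rw [← mul_sub, norm_mul, Real.norm_of_nonneg (by positivity : 0 ≤ l ^ (k + 1 + 1))]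
  calc l ^ (k + 1 + 1) * ‖genP μ (2 * (k + 1) + 1) 1 - genP ν (2 * (k + 1) + 1) 1‖
      ≤ l ^ (k + 1 + 1) * (2 * distSup μ ν / k.factorial) := by
        gcongr
        exact odd_diff_one μ ν hμ hν k
    _ = _ := by ring

theorem arith {l D E A B S A' B' S' : ℝ} (hl : 0 < l) (hD : 0 ≤ D) (hE : 0 < E)
    (hB : |B| ≤ E) (hA' : |A'| ≤ E) (hB' : |B'| ≤ E)
    (hS : l ≤ S) (hS' : l ≤ S') (dA : |A - A'| ≤ 2 * l * D * E) (dB : |B - B'| ≤ 2 * l * D * E)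
    (dS : |S - S'| ≤ 2 * l ^ 2 * D * E) :
    |A * B / S - A' * B' / S'| ≤ (1 / l + 2 * E + 4) * (E * E) * D := by
  have hSp : 0 < S := hl.trans_le hS
  have hSp' : 0 < S' := hl.trans_le hS'
  have e : A * B / S - A' * B' / S' =
      (A - A') * B / S + A' * (B - B') / S - A' * B' * (S - S') / (S * S') := by
    field_simp; ring
  have t1 : |(A - A') * B / S| ≤ (2 * l * D * E) * E / l := by
    rw [abs_div, abs_mul, abs_of_pos hSp]; gcongr
  have t2 : |A' * (B - B') / S| ≤ E * (2 * l * D * E) / l := by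
    rw [abs_div, abs_mul, abs_of_pos hSp]; gcongr
  have t3 : |A' * B' * (S - S') / (S * S')| ≤ E * E * (2 * l ^ 2 * D * E) / (l * l) := by
    rw [abs_div, abs_mul, abs_mul, abs_mul, abs_of_pos hSp, abs_of_pos hSp']; gcongr
  rw [e]
  refine (abs_sub _ _).trans ((add_le_add ((abs_add_le _ _).trans (add_le_add t1 t2)) t3).trans ?_)
  have e2 : (2 * l * D * E) * E / l + E * (2 * l * D * E) / l
      + E * E * (2 * l ^ 2 * D * E) / (l * l) = (2 * E + 4) * (E * E) * D := by
    field_simp; ring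
  rw [e2]
  have : 0 ≤ 1 / l := by positivity
  gcongr
  linarith

theorem rho_diff (μ ν : Measure ℝ) [IsProbabilityMeasure μ] [NullSingletonClass μ]
    [IsProbabilityMeasure ν] [NullSingletonClass ν] (hμ : μ (Icc (0:ℝ) 1)ᶜ = 0) (hν : ν (Icc (0:ℝ) 1)ᶜ = 0)
    {l : ℝ} (hl : 0 < l) {x y : ℝ} (hx : x ∈ Icc (0:ℝ) 1) (hy : y ∈ Icc (0:ℝ) 1) :
    |rhoN μ l x y - rhoN ν l x y|
        ≤ (1 / l + 2 * Real.exp l + 4) * Real.exp (2 * l) * distSup μ ν := by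
  have hm : min x y ∈ Icc (0:ℝ) 1 := ⟨le_min hx.1 hy.1, (min_le_left _ _).trans hx.2⟩
  have hM : 1 - max x y ∈ Icc (0:ℝ) 1 :=
    ⟨by linarith [max_le hx.2 hy.2], by linarith [hx.1.trans (le_max_left x y)]⟩
  rw [two_mul l, Real.exp_add]
  exact arith hl (distSup_nonneg μ ν) (Real.exp_pos l) (cosh_bd μ hl hM) (cosh_bd ν hl hm)
    (cosh_bd ν hl hM) (deriv_ge μ hμ hl) (deriv_ge ν hν hl) (cosh_diff μ ν hl hm)
    (cosh_diff μ ν hl hM) (deriv_diff μ ν hμ hν hl)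

theorem pointwise (μ : Measure ℝ) (μn : ℕ → Measure ℝ)
    [IsProbabilityMeasure μ] [∀ n, IsProbabilityMeasure (μn n)] [NullSingletonClass μ]
    (hweak : ∀ f : ℝ → ℝ, Continuous f →
      Tendsto (fun n => ∫ x, f x ∂(μn n)) atTop (nhds (∫ x, f x ∂μ))) (x : ℝ) :
    Tendsto (fun n => (μn n (Icc 0 x)).toReal) atTop (nhds (μ (Icc 0 x)).toReal) := by
  let P : ProbabilityMeasure ℝ := ⟨μ, inferInstance⟩
  let Pn : ℕ → ProbabilityMeasure ℝ := fun n => ⟨μn n, inferInstance⟩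
  have h : Tendsto Pn atTop (nhds P) :=
    ProbabilityMeasure.tendsto_iff_forall_integral_tendsto.2 (fun f => hweak f f.continuous)
  have hf : (P : Measure ℝ) (frontier (Icc 0 x)) = 0 := by
    show μ (frontier (Icc 0 x)) = 0
    have hsub : frontier (Icc 0 x) ⊆ {0, x} := by
      rcases le_or_gt 0 x with hx | hx
      · rw [frontier_Icc hx]
      · simp [Icc_eq_empty (not_le.2 hx)]
    exact measure_mono_null hsub ((Set.toFinite {0, x}).measure_zero μ)
  have := ProbabilityMeasure.tendsto_measure_of_null_frontier_of_tendsto' h hf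
  exact (ENNReal.tendsto_toReal (measure_ne_top μ _)).comp this

theorem dist_small (μ : Measure ℝ) (μn : ℕ → Measure ℝ)
    [IsProbabilityMeasure μ] [∀ n, IsProbabilityMeasure (μn n)] [NullSingletonClass μ]
    (hweak : ∀ f : ℝ → ℝ, Continuous f →
      Tendsto (fun n => ∫ x, f x ∂(μn n)) atTop (nhds (∫ x, f x ∂μ))) {ε : ℝ} (hε : 0 < ε) :
    ∃ N, ∀ n ≥ N, distSup μ (μn n) ≤ 2 * ε := by
  have hmono : ∀ (ρ : Measure ℝ) [IsProbabilityMeasure ρ] {a b : ℝ}, a ≤ b →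
      (ρ (Icc 0 a)).toReal ≤ (ρ (Icc 0 b)).toReal := by
    intro ρ _ a b hab
    exact ENNReal.toReal_mono (measure_ne_top ρ _) (measure_mono (Icc_subset_Icc_right hab))
  have hc : ContinuousOn (fun x => (μ (Icc 0 x)).toReal) (Icc 0 2) := by
    refine ContinuousOn.congr (f := fun x => ∫ _t in (0:ℝ)..x, (1:ℝ) ∂μ) ?_
      (fun x hx => (one_int μ hx.1).symm)
    exact (intervalIntegral.continuous_primitive
      (fun a b => continuous_const.intervalIntegrable a b) 0).continuousOn
  have hu := isCompact_Icc.uniformContinuousOn_of_continuous hc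
  obtain ⟨δ, hδ, hu⟩ := Metric.uniformContinuousOn_iff.1 hu ε hε
  obtain ⟨M, hM⟩ := exists_nat_one_div_lt hδ
  set m : ℝ := (M : ℝ) + 1 with hm
  have hm0 : 0 < m := by positivity
  have hm1 : 1 ≤ m := by rw [hm]; linarith [(Nat.cast_nonneg M : (0:ℝ) ≤ M)]
  have hgrid : ∀ᶠ n in atTop, ∀ k ∈ Finset.range (M + 3),
      |(μn n (Icc 0 ((k:ℝ) / m))).toReal - (μ (Icc 0 ((k:ℝ) / m))).toReal| < ε := by
    rw [Finset.eventually_all]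
    intro k _
    exact (Metric.tendsto_nhds.1 (pointwise μ μn hweak _) ε hε)
  obtain ⟨N, hN⟩ := eventually_atTop.1 hgrid
  refine ⟨N, fun n hn => ?_⟩
  have : Nonempty (Icc (0:ℝ) 1) := ⟨⟨0, by simp⟩⟩
  refine ciSup_le (fun ⟨x, hx⟩ => ?_)
  simp only
  set k := ⌊x * m⌋₊ with hk
  have hk1 : (k : ℝ) ≤ x * m := Nat.floor_le (by have := hx.1; positivity)
  have hk2 : x * m < k + 1 := Nat.lt_floor_add_one _
  have hkM : k ≤ M + 1 := by
    have : (k : ℝ) ≤ ((M + 1 : ℕ) : ℝ) := by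
      push_cast; rw [← hm]; nlinarith [hx.2]
    exact_mod_cast this
  have a1 := abs_lt.1 (hN n hn k (by simp; omega))
  have a2 := abs_lt.1 (hN n hn (k + 1) (by simp; omega))
  have l1 : (k : ℝ) / m ≤ x := by rw [div_le_iff₀ hm0]; exact hk1
  have l2 : x ≤ ((k + 1 : ℕ) : ℝ) / m := by rw [le_div_iff₀ hm0]; push_cast; exact hk2.le
  have l3 : ((k + 1 : ℕ) : ℝ) / m = (k : ℝ) / m + 1 / m := by push_cast; ring
  have l4 : 1 / m ≤ 1 := by rw [div_le_iff₀ hm0]; linarith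
  have l0 : 0 ≤ (k : ℝ) / m := by positivity
  have hx2 : x ∈ Icc (0:ℝ) 2 := ⟨hx.1, by linarith [hx.2]⟩
  have u1 := hu x hx2 ((k : ℝ) / m) ⟨l0, by linarith [hx.2]⟩
    (by rw [Real.dist_eq, abs_lt]; constructor <;> linarith)
  have u2 := hu x hx2 (((k + 1 : ℕ) : ℝ) / m) ⟨by linarith, by linarith [hx.2]⟩
    (by rw [Real.dist_eq, abs_lt]; constructor <;> linarith)
  rw [Real.dist_eq] at u1 u2
  have u1 := abs_lt.1 u1
  have u2 := abs_lt.1 u2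
  have m1 := hmono (μn n) l1
  have m2 := hmono (μn n) l2
  exact abs_le.2 ⟨by linarith, by linarith⟩

end helpers

theorem stmt_16 (μ : Measure ℝ) (μn : ℕ → Measure ℝ)
    [IsProbabilityMeasure μ] [∀ n, IsProbabilityMeasure (μn n)]
    (hμs : μ (Set.Icc (0:ℝ) 1)ᶜ = 0) (hns : ∀ n, μn n (Set.Icc (0:ℝ) 1)ᶜ = 0)
    (hna : ∀ x : ℝ, μ {x} = 0) (hnan : ∀ n, ∀ x : ℝ, μn n {x} = 0)
    (hsupp0 : ∀ ε > (0:ℝ), 0 < μ (Set.Icc 0 ε)) (hsupp1 : ∀ ε > (0:ℝ), 0 < μ (Set.Icc (1 - ε) 1))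
    (hsupp0n : ∀ n, ∀ ε > (0:ℝ), 0 < μn n (Set.Icc 0 ε))
    (hsupp1n : ∀ n, ∀ ε > (0:ℝ), 0 < μn n (Set.Icc (1 - ε) 1))
    (hweak : ∀ f : ℝ → ℝ, Continuous f →
      Tendsto (fun n => ∫ x, f x ∂(μn n)) atTop (nhds (∫ x, f x ∂μ)))
    (l : ℝ) (hl : 0 < l) :
    (∀ n : ℕ, ∀ x ∈ Set.Icc (0:ℝ) 1, ∀ y ∈ Set.Icc (0:ℝ) 1,
      |rhoN μ l x y - rhoN (μn n) l x y|
        ≤ (1 / l + 2 * Real.exp l + 4) * Real.exp (2 * l) * distSup μ (μn n)) ∧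
    (∀ ε > (0:ℝ), ∃ N : ℕ, ∀ n ≥ N, ∀ x ∈ Set.Icc (0:ℝ) 1, ∀ y ∈ Set.Icc (0:ℝ) 1,
      |rhoN μ l x y - rhoN (μn n) l x y| < ε) := by
  haveI : NullSingletonClass μ := ⟨hna⟩
  haveI : ∀ n, NullSingletonClass (μn n) := fun n => ⟨hnan n⟩
  have main : ∀ n : ℕ, ∀ x ∈ Set.Icc (0:ℝ) 1, ∀ y ∈ Set.Icc (0:ℝ) 1,
      |rhoN μ l x y - rhoN (μn n) l x y|
        ≤ (1 / l + 2 * Real.exp l + 4) * Real.exp (2 * l) * distSup μ (μn n) :=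
    fun n x hx y hy => rho_diff μ (μn n) hμs (hns n) hl hx hy
  refine ⟨main, fun ε hε => ?_⟩
  set K := (1 / l + 2 * Real.exp l + 4) * Real.exp (2 * l) with hK
  have hKp : 0 < K := by positivity
  obtain ⟨N, hN⟩ := dist_small μ μn hweak (ε := ε / (4 * K)) (by positivity)
  refine ⟨N, fun n hn x hx y hy => (main n x hx y hy).trans_lt ?_⟩
  calc K * distSup μ (μn n) ≤ K * (2 * (ε / (4 * K))) := by gcongr; exact hN n hn
    _ = ε / 2 := by field_simp; ring
    _ < ε := by linarith
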